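/- arXiv:1804.00639 — 3 statements merged into one kernel-verified Lean document; each statement's English description precedes it below -/
import Mathlib

section
/- Let K be a field of characteristic ≠ 2 and let L be a 2-dimensional subspace of the 3-dimensional space Q of symmetric bilinear forms on K². Then the cycle pairing restricted to L is nondegenerate if and only if the forms in L have no common zero point on the projective line, i.e., if and only if there is no nonzero vector v ∈ K² such that q(v, v) = 0 for every q ∈ L. -/
/-- The cycle pairing on the space `Q` of symmetric bilinear forms on `K²`, where the form
with matrix `[[A, B/2],[B/2, C]]` (i.e. the cycle `A X² + B X + C`) is identified with the
coefficient vector `![A, B, C] : Fin 3 → K`. -/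
def cyclePairing {K : Type*} [Field K] (p q : Fin 3 → K) : K :=
  p 1 * q 1 - 2 * p 0 * q 2 - 2 * q 0 * p 2

/-- Over a field of characteristic ≠ 2, a 2-dimensional subspace `L` of the
3-dimensional space of symmetric bilinear forms on `K²` is regular for the cycle pairing
iff there is no nonzero vector `v ∈ K²` with `q(v, v) = 0` for every `q ∈ L`, i.e. iff the
forms in `L` have no common zero point on the projective line. Here the form `![A, B, C]`
evaluates on `v` as `A v₀² + B v₀ v₁ + C v₁²`. -/
theorem regular_iff_no_common_zero {K : Type*} [Field K] (h2 : (2 : K) ≠ 0)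
    (L : Submodule K (Fin 3 → K)) (hdim : Module.finrank K L = 2) :
    (∀ p ∈ L, (∀ q ∈ L, cyclePairing p q = 0) → p = 0) ↔
      ¬ ∃ v : Fin 2 → K, v ≠ 0 ∧
        ∀ p ∈ L, p 0 * v 0 ^ 2 + p 1 * (v 0 * v 1) + p 2 * v 1 ^ 2 = 0 := by
  constructor
  · rintro hreg ⟨v, hv, hzero⟩
    let φ : Module.Dual K (Fin 3 → K) :=
      v 0 ^ 2 • LinearMap.proj 0 + (v 0 * v 1) • LinearMap.proj 1 + v 1 ^ 2 • LinearMap.proj 2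
    have hφ (p : Fin 3 → K) :
        φ p = v 0 ^ 2 * p 0 + v 0 * v 1 * p 1 + v 1 ^ 2 * p 2 := by
      simp [φ]
    have hcoord : ¬ (v 0 = 0 ∧ v 1 = 0) := by
      rintro ⟨h0, h1⟩
      exact hv (funext fun i => by fin_cases i <;> assumption)
    have hφ0 : φ ≠ 0 := by
      intro h
      apply hcoord
      constructor
      · simpa [h, eq_comm (a := (0 : K))] using hφ ![1, 0, 0]
      · simpa [h, eq_comm (a := (0 : K))] using hφ ![0, 0, 1]
    have hle : L ≤ LinearMap.ker φ := fun p hp => by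
      rw [LinearMap.mem_ker, hφ]
      linear_combination hzero p hp
    have hker := Module.Dual.finrank_ker_add_one_of_ne_zero hφ0
    rw [Module.finrank_fin_fun] at hker
    have hL : L = LinearMap.ker φ := Submodule.eq_of_le_of_finrank_eq hle (by lia)
    -- the square of the linear form vanishing at `v` spans the orthogonal complement of `L`
    have hn := hreg ![v 1 ^ 2, -2 * (v 0 * v 1), v 0 ^ 2]
      (by rw [hL, LinearMap.mem_ker, hφ]; simp; ring)
      (fun q hq => by simp [cyclePairing]; linear_combination -2 * hzero q hq)
    apply hcoord
    constructor
    · simpa using congrFun hn 2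
    · simpa using congrFun hn 0
  · intro hno p hp horth
    have hdisc : p 1 * p 1 - 2 * p 0 * p 2 - 2 * p 0 * p 2 = 0 := horth p hp
    by_contra hp0
    apply hno
    by_cases h0 : p 0 = 0
    · have h1 : p 1 = 0 := by simpa [h0] using hdisc
      have h3 : p 2 ≠ 0 := fun h =>
        hp0 (funext fun i => by fin_cases i <;> assumption)
      refine ⟨![1, 0], fun h => one_ne_zero (congrFun h 0), fun q hq => ?_⟩
      have := horth q hq
      simpa [cyclePairing, h0, h1, h2, h3] using this
    · refine ⟨![-p 1, 2 * p 0], fun h => mul_ne_zero h2 h0 (congrFun h 1), fun q hq => ?_⟩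
      have hq' : p 1 * q 1 - 2 * p 0 * q 2 - 2 * q 0 * p 2 = 0 := horth q hq
      simp only [Matrix.cons_val_zero, Matrix.cons_val_one]
      linear_combination q 0 * hdisc - 2 * p 0 * hq'
end

section
/- Let K be a field and let M, N, P be three points of the affine plane K² that are not collinear (i.e., P − N and P − M are linearly independent). Then the three altitude lines of the triangle MNP with respect to the standard dot product are concurrent: there exists a unique point T ∈ K² such that (T − M)·(P − N) = 0, (T − N)·(P − M) = 0, and (T − P)·(N − M) = 0, where (x₁,x₂)·(y₁,y₂) = x₁y₁ + x₂y₂. The point T is called the orthocenter of the triangle MNP. -/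
/-- The standard dot product on `K²`. -/
def dotK {K : Type*} [Field K] (x y : Fin 2 → K) : K :=
  x 0 * y 0 + x 1 * y 1

theorem det_ne_zero_of_linearIndependent_pair {K : Type*} [Field K] {a b : Fin 2 → K}
    (h : LinearIndependent K ![a, b]) : a 0 * b 1 - a 1 * b 0 ≠ 0 := by
  have hu : IsUnit (Matrix.of ![a, b]) := Matrix.linearIndependent_rows_iff_isUnit.mp h
  simpa [Matrix.det_fin_two] using ((Matrix.isUnit_iff_isUnit_det _).mp hu).ne_zero

/-- Two linear equations with linearly independent coefficient vectors have a unique solution. -/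
theorem existsUnique_dotK_eq {K : Type*} [Field K] {a b : Fin 2 → K}
    (h : LinearIndependent K ![a, b]) (s t : K) :
    ∃! x : Fin 2 → K, dotK x a = s ∧ dotK x b = t := by
  have hd := det_ne_zero_of_linearIndependent_pair h
  refine ⟨![(s * b 1 - t * a 1) / (a 0 * b 1 - a 1 * b 0),
    (a 0 * t - b 0 * s) / (a 0 * b 1 - a 1 * b 0)], ⟨?_, ?_⟩, ?_⟩
  · simp only [dotK, Matrix.cons_val_zero, Matrix.cons_val_one]
    rw [div_mul_eq_mul_div, div_mul_eq_mul_div, ← add_div, div_eq_iff hd]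
    ring
  · simp only [dotK, Matrix.cons_val_zero, Matrix.cons_val_one]
    rw [div_mul_eq_mul_div, div_mul_eq_mul_div, ← add_div, div_eq_iff hd]
    ring
  · rintro x ⟨hs, ht⟩
    simp only [dotK] at hs ht
    refine funext (Fin.forall_fin_two.mpr ⟨(eq_div_iff hd).mpr ?_, (eq_div_iff hd).mpr ?_⟩)
    · linear_combination b 1 * hs - a 1 * ht
    · linear_combination a 0 * ht - b 0 * hs

/-- For any field `K` and any three non-collinear points `M, N, P` of the
affine plane `K²`, the three altitude lines of the triangle `MNP` (with respect to the
standard dot product) are concurrent: there is a unique point `T` with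
`(T - M)·(P - N) = 0`, `(T - N)·(P - M) = 0` and `(T - P)·(N - M) = 0`
(the orthocenter of the triangle `MNP`). -/
theorem orthocenter_exists_unique {K : Type*} [Field K] (M N P : Fin 2 → K)
    (h : LinearIndependent K ![P - N, P - M]) :
    ∃! T : Fin 2 → K,
      dotK (T - M) (P - N) = 0 ∧ dotK (T - N) (P - M) = 0 ∧
        dotK (T - P) (N - M) = 0 := by
  obtain ⟨T, ⟨hM, hN⟩, hT⟩ := existsUnique_dotK_eq h (dotK M (P - N)) (dotK N (P - M))
  refine ⟨T, ⟨?_, ?_, ?_⟩, fun x ⟨hxM, hxN, _⟩ => hT x ⟨?_, ?_⟩⟩ <;>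
    simp only [dotK, Pi.sub_apply] at *
  · linear_combination hM
  · linear_combination hN
  · linear_combination hN - hM
  · linear_combination hxM
  · linear_combination hxN
end

section
/- Nine-point circle theorem for an arbitrary field: let K be a field of characteristic ≠ 2 and let M, N, P ∈ K² be non-collinear points with orthocenter T (so (T − M)·(P − N) = 0, (T − N)·(P − M) = 0, (T − P)·(N − M) = 0, with the standard dot product). Assume T does not lie on any of the lines MN, NP, MP (so the four points M, N, P, T are in general position). Then there exist α, β, γ ∈ K such that the circle f(x₁, x₂) = x₁² + x₂² + αx₁ + βx₂ + γ = 0 passes through the following nine points: the six midpoints (1/2)(M+N), (1/2)(M+P), (1/2)(N+P), (1/2)(M+T), (1/2)(N+T), (1/2)(P+T), and every point lying simultaneously on the two lines of each of the three pairs (line MT, line NP), (line NT, line MP), (line PT, line MN). -/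
theorem dotK_zero_left {K : Type*} [Field K] (y : Fin 2 → K) : dotK 0 y = 0 := by
  simp [dotK]

theorem dotK_zero_right {K : Type*} [Field K] (x : Fin 2 → K) : dotK x 0 = 0 := by
  simp [dotK]

/-- A common point of two perpendicular lines `AB` and `CD` is seen under a right angle from the
midpoints of `AB` and `CD`. -/
theorem dotK_sub_midpoint_eq_zero {K : Type*} [Field K] (h2 : (2 : K) ≠ 0)
    {A B C D x : Fin 2 → K} (h : dotK (B - A) (D - C) = 0)
    (hAB : ∃ t : K, x = A + t • (B - A)) (hCD : ∃ s : K, x = C + s • (D - C)) :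
    dotK (x - (2 : K)⁻¹ • (A + B)) (x - (2 : K)⁻¹ • (C + D)) = 0 := by
  have sub_midpoint (E F : Fin 2 → K) (r : K) :
      E + r • (F - E) - (2 : K)⁻¹ • (E + F) = (r - (2 : K)⁻¹) • (F - E) := by
    ext i
    simp only [Pi.add_apply, Pi.sub_apply, Pi.smul_apply, smul_eq_mul]
    linear_combination -E i * mul_inv_cancel₀ h2
  obtain ⟨t, ht⟩ := hAB
  obtain ⟨s, hs⟩ := hCD
  have hx : x - (2 : K)⁻¹ • (A + B) = (t - (2 : K)⁻¹) • (B - A) := by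
    rw [ht, sub_midpoint]
  have hx' : x - (2 : K)⁻¹ • (C + D) = (s - (2 : K)⁻¹) • (D - C) := by
    rw [hs, sub_midpoint]
  rw [hx, hx']
  simp only [dotK, Pi.smul_apply, smul_eq_mul] at h ⊢
  linear_combination (t - (2 : K)⁻¹) * (s - (2 : K)⁻¹) * h

/-- nine-point circle over an arbitrary field of characteristic ≠ 2:
let `M, N, P ∈ K²` be non-collinear points with orthocenter `T`, and assume `T` lies on
none of the lines `MN`, `NP`, `MP`. Then there is a circle
`x₁² + x₂² + α x₁ + β x₂ + γ = 0` passing through the six midpoints of the segments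
`MN, MP, NP, MT, NT, PT` and through every common point of each of the three pairs of
lines `(MT, NP)`, `(NT, MP)`, `(PT, MN)`. -/
theorem nine_point_circle {K : Type*} [Field K] (h2 : (2 : K) ≠ 0)
    (M N P T : Fin 2 → K)
    (hcol : LinearIndependent K ![P - N, P - M])
    (hT1 : dotK (T - M) (P - N) = 0) (hT2 : dotK (T - N) (P - M) = 0)
    (hT3 : dotK (T - P) (N - M) = 0)
    (hMN : ∀ t : K, T ≠ M + t • (N - M))
    (hNP : ∀ t : K, T ≠ N + t • (P - N))
    (hMP : ∀ t : K, T ≠ M + t • (P - M)) :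
    ∃ α β γ : K,
      (∀ x : Fin 2 → K,
        (x = (2 : K)⁻¹ • (M + N) ∨ x = (2 : K)⁻¹ • (M + P) ∨ x = (2 : K)⁻¹ • (N + P) ∨
         x = (2 : K)⁻¹ • (M + T) ∨ x = (2 : K)⁻¹ • (N + T) ∨ x = (2 : K)⁻¹ • (P + T)) →
        x 0 ^ 2 + x 1 ^ 2 + α * x 0 + β * x 1 + γ = 0) ∧
      (∀ x : Fin 2 → K,
        (((∃ t : K, x = M + t • (T - M)) ∧ (∃ s : K, x = N + s • (P - N))) ∨
         ((∃ t : K, x = N + t • (T - N)) ∧ (∃ s : K, x = M + s • (P - M))) ∨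
         ((∃ t : K, x = P + t • (T - P)) ∧ (∃ s : K, x = M + s • (N - M)))) →
        x 0 ^ 2 + x 1 ^ 2 + α * x 0 + β * x 1 + γ = 0) := by
  have circle_eq_MT_NP (x : Fin 2 → K) : x 0 ^ 2 + x 1 ^ 2
      + -(2 : K)⁻¹ * (M 0 + N 0 + P 0 + T 0) * x 0 + -(2 : K)⁻¹ * (M 1 + N 1 + P 1 + T 1) * x 1
      + (2 : K)⁻¹ ^ 2 * dotK (M + T) (N + P)
      = dotK (x - (2 : K)⁻¹ • (M + T)) (x - (2 : K)⁻¹ • (N + P)) := by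
    simp only [dotK, Pi.add_apply, Pi.sub_apply, Pi.smul_apply, smul_eq_mul]
    ring
  have circle_eq_NT_MP (x : Fin 2 → K) : x 0 ^ 2 + x 1 ^ 2
      + -(2 : K)⁻¹ * (M 0 + N 0 + P 0 + T 0) * x 0 + -(2 : K)⁻¹ * (M 1 + N 1 + P 1 + T 1) * x 1
      + (2 : K)⁻¹ ^ 2 * dotK (M + T) (N + P)
      = dotK (x - (2 : K)⁻¹ • (N + T)) (x - (2 : K)⁻¹ • (M + P)) := by
    simp only [dotK, Pi.add_apply, Pi.sub_apply, Pi.smul_apply, smul_eq_mul] at hT3 ⊢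
    linear_combination (2 : K)⁻¹ ^ 2 * hT3
  have circle_eq_PT_MN (x : Fin 2 → K) : x 0 ^ 2 + x 1 ^ 2
      + -(2 : K)⁻¹ * (M 0 + N 0 + P 0 + T 0) * x 0 + -(2 : K)⁻¹ * (M 1 + N 1 + P 1 + T 1) * x 1
      + (2 : K)⁻¹ ^ 2 * dotK (M + T) (N + P)
      = dotK (x - (2 : K)⁻¹ • (P + T)) (x - (2 : K)⁻¹ • (M + N)) := by
    simp only [dotK, Pi.add_apply, Pi.sub_apply, Pi.smul_apply, smul_eq_mul] at hT2 ⊢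
    linear_combination (2 : K)⁻¹ ^ 2 * hT2
  refine ⟨-(2 : K)⁻¹ * (M 0 + N 0 + P 0 + T 0), -(2 : K)⁻¹ * (M 1 + N 1 + P 1 + T 1),
    (2 : K)⁻¹ ^ 2 * dotK (M + T) (N + P), ?_, ?_⟩
  · rintro x (rfl | rfl | rfl | rfl | rfl | rfl)
    · rw [circle_eq_PT_MN, sub_self, dotK_zero_right]
    · rw [circle_eq_NT_MP, sub_self, dotK_zero_right]
    · rw [circle_eq_MT_NP, sub_self, dotK_zero_right]
    · rw [circle_eq_MT_NP, sub_self, dotK_zero_left]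
    · rw [circle_eq_NT_MP, sub_self, dotK_zero_left]
    · rw [circle_eq_PT_MN, sub_self, dotK_zero_left]
  · rintro x (⟨hx, hx'⟩ | ⟨hx, hx'⟩ | ⟨hx, hx'⟩)
    · rw [circle_eq_MT_NP, dotK_sub_midpoint_eq_zero h2 hT1 hx hx']
    · rw [circle_eq_NT_MP, dotK_sub_midpoint_eq_zero h2 hT2 hx hx']
    · rw [circle_eq_PT_MN, dotK_sub_midpoint_eq_zero h2 hT3 hx hx']
end
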